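/- Let Ω be a bounded open set with smooth boundary whose closure is contained in B, let (8 - n)/3 < α < 2 with n > 2, and let R > sup_{x ∈ Ω} d(x). Then for every φ ∈ C_c^∞(Ω ∖ {0}), ∫_Ω d^α λ^{-n} (div(λ^{n-2} ∇φ))² dx ≥ ((n - α)²/4) ∫_Ω d^{α-2} |∇φ|² λ^{n-2} dx + K ∫_Ω d^{α-4} (log(R/d))^{-2} φ² λ^n dx, where K = (n - α)(n + 3α - 8)/16. -/

import Mathlib

open MeasureTheory Bornology

/-- Conformal factor of the Poincaré ball model. -/
noncomputable def lam {n : ℕ} (x : EuclideanSpace ℝ (Fin n)) : ℝ := 2 / (1 - ‖x‖ ^ 2)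

/-- Hyperbolic distance to the origin in the Poincaré ball model. -/
noncomputable def dH {n : ℕ} (x : EuclideanSpace ℝ (Fin n)) : ℝ :=
  Real.log ((1 + ‖x‖) / (1 - ‖x‖))

/-- Euclidean divergence of a vector field on ℝⁿ. -/
noncomputable def dvg {n : ℕ} (V : EuclideanSpace ℝ (Fin n) → EuclideanSpace ℝ (Fin n))
    (x : EuclideanSpace ℝ (Fin n)) : ℝ :=
  ∑ i, fderiv ℝ V x (EuclideanSpace.single i 1) i

lemma integral_fderiv_apply_eq_zero {E : Type*} [NormedAddCommGroup E] [NormedSpace ℝ E]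
    [FiniteDimensional ℝ E] [MeasurableSpace E] [BorelSpace E] (μ : Measure E)
    [μ.IsAddHaarMeasure] {g : E → ℝ} (hg : ContDiff ℝ 1 g) (hc : HasCompactSupport g) (v : E) :
    ∫ x, fderiv ℝ g x v ∂μ = 0 := by
  have hcont : Continuous fun x => fderiv ℝ g x v :=
    (hg.continuous_fderiv one_ne_zero).clm_apply continuous_const
  have hcs : HasCompactSupport fun x => fderiv ℝ g x v := hc.fderiv_apply (𝕜 := ℝ) v
  have := integral_mul_fderiv_eq_neg_fderiv_mul_of_integrable (μ := μ) (f := fun _ : E => (1 : ℝ))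
    (g := g) (v := v) (by simp) (by simpa using hcont.integrable_of_hasCompactSupport hcs)
    (by simpa using hg.continuous.integrable_of_hasCompactSupport hc)
    (fun x _ => differentiableAt_const _) (fun x _ => hg.differentiable one_ne_zero x)
  simpa using this

section divergence

variable {n : ℕ}

lemma fderiv_coord_apply {V : EuclideanSpace ℝ (Fin n) → EuclideanSpace ℝ (Fin n)}
    {x : EuclideanSpace ℝ (Fin n)} (hV : DifferentiableAt ℝ V x) (i : Fin n)
    (v : EuclideanSpace ℝ (Fin n)) :
    fderiv ℝ (fun y => V y i) x v = fderiv ℝ V x v i := by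
  have h := (EuclideanSpace.proj (𝕜 := ℝ) i).hasFDerivAt.comp x hV.hasFDerivAt
  have h' : HasFDerivAt (fun y => V y i)
    ((EuclideanSpace.proj (𝕜 := ℝ) i).comp (fderiv ℝ V x)) x := h
  rw [h'.fderiv]
  rfl

lemma integrable_dvg {V : EuclideanSpace ℝ (Fin n) → EuclideanSpace ℝ (Fin n)}
    (hV : ContDiff ℝ 1 V) (hc : HasCompactSupport V) : Integrable (dvg V) := by
  refine integrable_finsetSum _ fun i _ => ?_
  have hcont : Continuous fun x => fderiv ℝ V x (EuclideanSpace.single i 1) i :=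
    (EuclideanSpace.proj (𝕜 := ℝ) i).continuous.comp
      ((hV.continuous_fderiv one_ne_zero).clm_apply continuous_const)
  exact hcont.integrable_of_hasCompactSupport
    ((hc.fderiv_apply (𝕜 := ℝ) _).comp_left (g := fun z : EuclideanSpace ℝ (Fin n) => z i) rfl)

lemma integral_dvg_eq_zero {V : EuclideanSpace ℝ (Fin n) → EuclideanSpace ℝ (Fin n)}
    (hV : ContDiff ℝ 1 V) (hc : HasCompactSupport V) : ∫ x, dvg V x = 0 := by
  have hcoord : ∀ i, ContDiff ℝ 1 fun x => V x i := fun i =>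
    (EuclideanSpace.proj (𝕜 := ℝ) i).contDiff.comp hV
  have hcs : ∀ i, HasCompactSupport fun x => V x i := fun i =>
    hc.comp_left (g := fun z : EuclideanSpace ℝ (Fin n) => z i) rfl
  have heq : dvg V = fun x => ∑ i, fderiv ℝ (fun y => V y i) x (EuclideanSpace.single i 1) := by
    funext x
    exact Finset.sum_congr rfl fun i _ =>
      (fderiv_coord_apply (hV.differentiable one_ne_zero x) i _).symm
  rw [heq, integral_finsetSum]
  · exact Finset.sum_eq_zero fun i _ =>
      integral_fderiv_apply_eq_zero _ (hcoord i) (hcs i) _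
  · intro i _
    exact (((hcoord i).continuous_fderiv one_ne_zero).clm_apply
      continuous_const).integrable_of_hasCompactSupport ((hcs i).fderiv_apply (𝕜 := ℝ) _)

lemma dvg_smul {c : EuclideanSpace ℝ (Fin n) → ℝ}
    {X : EuclideanSpace ℝ (Fin n) → EuclideanSpace ℝ (Fin n)} {x : EuclideanSpace ℝ (Fin n)}
    (hc : DifferentiableAt ℝ c x) (hX : DifferentiableAt ℝ X x) :
    dvg (fun y => c y • X y) x = fderiv ℝ c x (X x) + c x * dvg X x := by
  have hsum : X x = ∑ i, X x i • EuclideanSpace.single i (1 : ℝ) := by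
    ext j
    simp [Finset.sum_apply, Pi.single_apply]
  have h1 : fderiv ℝ c x (X x) = ∑ i, X x i * fderiv ℝ c x (EuclideanSpace.single i 1) := by
    conv_lhs => rw [hsum]
    simp
  rw [h1]
  unfold dvg
  rw [fderiv_fun_smul hc hX, Finset.mul_sum, ← Finset.sum_add_distrib]
  refine Finset.sum_congr rfl fun i _ => ?_
  simp
  ring

lemma dvg_add {V W : EuclideanSpace ℝ (Fin n) → EuclideanSpace ℝ (Fin n)}
    {x : EuclideanSpace ℝ (Fin n)} (hV : DifferentiableAt ℝ V x) (hW : DifferentiableAt ℝ W x) :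
    dvg (fun y => V y + W y) x = dvg V x + dvg W x := by
  unfold dvg
  rw [fderiv_fun_add hV hW, ← Finset.sum_add_distrib]
  simp

lemma dvg_id (x : EuclideanSpace ℝ (Fin n)) : dvg (fun y => y) x = n := by
  simp [dvg]

lemma dvg_eq_zero_of_notMem_tsupport {V : EuclideanSpace ℝ (Fin n) → EuclideanSpace ℝ (Fin n)}
    {x : EuclideanSpace ℝ (Fin n)} (hx : x ∉ tsupport V) : dvg V x = 0 := by
  have : fderiv ℝ V x = 0 := by
    by_contra h
    exact hx (support_fderiv_subset ℝ h)
  simp [dvg, this]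

end divergence

section radial

lemma hasFDerivAt_norm_of_ne_zero {E : Type*} [NormedAddCommGroup E] [InnerProductSpace ℝ E]
    {x : E} (hx : x ≠ 0) : HasFDerivAt (fun y : E => ‖y‖) (‖x‖⁻¹ • innerSL ℝ x) x := by
  have h := (hasStrictFDerivAt_norm_sq x).hasFDerivAt.sqrt (by simpa using hx)
  have hfun : (fun y : E => √(‖y‖ ^ 2)) = fun y => ‖y‖ := by
    funext y
    exact Real.sqrt_sq (norm_nonneg y)
  rw [hfun] at h
  convert! h using 1
  ext v
  have : ‖x‖ ≠ 0 := by simpa using hx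
  simp [Real.sqrt_sq (norm_nonneg x)]
  field_simp

lemma fderiv_mul_radial {E : Type*} [NormedAddCommGroup E] [InnerProductSpace ℝ E]
    {ψ : E → ℝ} {b : ℝ → ℝ} {b' : ℝ} {x : E} (hx : x ≠ 0) (hψ : DifferentiableAt ℝ ψ x)
    (hb : HasDerivAt b b' ‖x‖) (v : E) :
    fderiv ℝ (fun y => ψ y * b ‖y‖) x v =
      fderiv ℝ ψ x v * b ‖x‖ + ψ x * (b' * (inner ℝ x v / ‖x‖)) := by
  have h := hψ.hasFDerivAt.mul (hb.comp_hasFDerivAt x (hasFDerivAt_norm_of_ne_zero hx))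
  have h' : HasFDerivAt (fun y => ψ y * b ‖y‖) _ x := h
  rw [h'.fderiv]
  simp
  ring

end radial

section hyperbolicRadius

/-- Hyperbolic distance to the origin as a function of the Euclidean radius. -/
noncomputable def hypRadius (r : ℝ) : ℝ := Real.log ((1 + r) / (1 - r))

/-- Conformal factor as a function of the Euclidean radius. -/
noncomputable def conformalRadial (r : ℝ) : ℝ := 2 / (1 - r ^ 2)

lemma conformalRadial_pos {r : ℝ} (h0 : 0 ≤ r) (h1 : r < 1) : 0 < conformalRadial r :=
  div_pos two_pos (by nlinarith)

lemma two_mul_le_hypRadius {r : ℝ} (h0 : 0 ≤ r) (h1 : r < 1) : 2 * r ≤ hypRadius r := by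
  have := Real.sum_range_le_log_div h0 h1 1
  simp at this
  unfold hypRadius
  linarith

lemma hypRadius_pos {r : ℝ} (h0 : 0 < r) (h1 : r < 1) : 0 < hypRadius r := by
  linarith [two_mul_le_hypRadius h0.le h1]

/-- The comparison `ρ coth ρ ≥ 1`, in terms of the Euclidean radius. -/
lemma one_le_hypRadius_mul_coth {r : ℝ} (h0 : 0 < r) (h1 : r < 1) :
    1 ≤ hypRadius r * ((1 + r ^ 2) / (2 * r)) := by
  have h := two_mul_le_hypRadius h0.le h1
  rw [← mul_div_assoc, le_div_iff₀ (by positivity)]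
  nlinarith [sq_nonneg r]

lemma hasDerivAt_hypRadius {r : ℝ} (h0 : 0 ≤ r) (h1 : r < 1) :
    HasDerivAt hypRadius (conformalRadial r) r := by
  have h2 : 1 - r ≠ 0 := by linarith
  have h3 : 1 + r ≠ 0 := by linarith
  have h4 : 1 - r ^ 2 ≠ 0 := by nlinarith
  have h := (((hasDerivAt_id' r).const_add 1).div ((hasDerivAt_id' r).const_sub 1) h2).log
    (div_ne_zero h3 h2)
  refine h.congr_deriv ?_
  unfold conformalRadial
  simp only [Pi.div_apply]
  field_simp
  ring

lemma hasDerivAt_conformalRadial {r : ℝ} (h0 : 0 ≤ r) (h1 : r < 1) :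
    HasDerivAt conformalRadial (r * conformalRadial r ^ 2) r := by
  have h4 : 1 - r ^ 2 ≠ 0 := by nlinarith
  have h := (hasDerivAt_const r (2 : ℝ)).div ((hasDerivAt_pow 2 r).const_sub 1) h4
  refine h.congr_deriv ?_
  unfold conformalRadial
  field_simp
  ring

lemma hasDerivAt_hypRadius_rpow (p : ℝ) {r : ℝ} (h0 : 0 < r) (h1 : r < 1) :
    HasDerivAt (fun s => hypRadius s ^ p)
      (p * hypRadius r ^ (p - 1) * conformalRadial r) r := by
  refine ((hasDerivAt_hypRadius h0.le h1).rpow_const (Or.inl (hypRadius_pos h0 h1).ne')).congr_deriv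
    ?_
  ring

/-- Radial profile of the correction field `φ² k(ρ) λ^(m-1) x / |x|`, with
`k(ρ) = ρ^(α-3) (a + b / log (R / ρ))`. -/
noncomputable def radialProfile (m α R a b r : ℝ) : ℝ :=
  hypRadius r ^ (α - 3) * (a + b * (Real.log (R / hypRadius r))⁻¹) *
    conformalRadial r ^ (m - 1) * r⁻¹

lemma hasDerivAt_radialProfile (m α a b : ℝ) {r R : ℝ} (h0 : 0 < r) (h1 : r < 1)
    (hR : hypRadius r < R) :
    HasDerivAt (radialProfile m α R a b)
      (r⁻¹ * (hypRadius r ^ (α - 4) * conformalRadial r ^ m *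
        ((α - 3) * (a + b * (Real.log (R / hypRadius r))⁻¹) +
          b * (Real.log (R / hypRadius r))⁻¹ ^ 2 +
          (m - 1) * (hypRadius r * ((1 + r ^ 2) / (2 * r))) *
            (a + b * (Real.log (R / hypRadius r))⁻¹)) - m * radialProfile m α R a b r)) r := by
  have hρ := hypRadius_pos h0 h1
  have hl := conformalRadial_pos h0.le h1
  have hL : 0 < Real.log (R / hypRadius r) := Real.log_pos ((one_lt_div hρ).2 hR)
  have hRpos : 0 < R := hρ.trans hR
  have d1 := hasDerivAt_hypRadius_rpow (α - 3) h0 h1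
  have d2 := ((((hasDerivAt_const r R).div (hasDerivAt_hypRadius h0.le h1) hρ.ne').log
    (div_ne_zero hRpos.ne' hρ.ne')).inv hL.ne').const_mul b |>.const_add a
  have d3 := (hasDerivAt_conformalRadial h0.le h1).rpow_const (p := m - 1) (Or.inl hl.ne')
  have d := ((d1.mul d2).mul d3).mul (hasDerivAt_inv h0.ne')
  refine HasDerivAt.congr_deriv (f' := _) d ?_
  simp only [Pi.mul_apply, Pi.div_apply, Pi.inv_apply, radialProfile]
  have e1 : hypRadius r ^ (α - 3) = hypRadius r ^ (α - 4) * hypRadius r := by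
    rw [← Real.rpow_add_one hρ.ne']; ring_nf
  have e1' : hypRadius r ^ (α - 3 - 1) = hypRadius r ^ (α - 4) := by ring_nf
  have e2 : conformalRadial r ^ (m - 1) = conformalRadial r ^ (m - 1 - 1) * conformalRadial r := by
    rw [← Real.rpow_add_one hl.ne']; ring_nf
  have e3 : conformalRadial r ^ m =
      conformalRadial r ^ (m - 1 - 1) * conformalRadial r * conformalRadial r := by
    rw [← e2, ← Real.rpow_add_one hl.ne']; ring_nf
  rw [e1', e1, e3, e2]
  generalize hypRadius r ^ (α - 4) = t
  generalize conformalRadial r ^ (m - 1 - 1) = q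
  generalize Real.log (R / hypRadius r) = L at *
  have h4 : 1 - r ^ 2 ≠ 0 := by nlinarith
  generalize hypRadius r = ρ at *
  unfold conformalRadial
  field_simp
  ring

end hyperbolicRadius

/-- The algebraic core: after completing squares, the divergence of the correction field together
with the left-hand integrands is dominated by the right-hand integrand. -/
lemma rellich_algebraic {m α t q l ρ Li f w G D σ h ε K a b : ℝ}
    (hh : h = (m + α - 4) / 2) (hε : ε = h * (m - α) / 4)
    (hK : K = (m - α) * (m + 3 * α - 8) / 16)
    (ha : a = -4 * K * h - 2 * ε * (2 - α)) (hb : b = -2 * K)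
    (hm : 1 ≤ m) (hh0 : 0 ≤ h) (hε0 : 0 ≤ ε) (hK0 : 0 ≤ K) (hα : α ≤ 2)
    (ht : 0 < t) (hq : 0 < q) (hl : 0 < l) (hLi : 0 ≤ Li) (hσ : 1 ≤ σ)
    (hG : w ^ 2 ≤ G) :
    (m - α) ^ 2 / 4 * (t * ρ ^ 2 * G * q) + K * (t * (f ^ 2 * Li ^ 2) * (q * l ^ 2)) +
      (-4 * ε * (t * ρ ^ 2 * f * D + q * (t * ρ ^ 2 * G + f * (α - 2) * (t * ρ) * l * w)) +
        2 * f * w * (t * ρ) * (a + b * Li) * (q * l) +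
        f ^ 2 * (t * (q * l ^ 2) *
          ((α - 3) * (a + b * Li) + b * Li ^ 2 + (m - 1) * σ * (a + b * Li)))) ≤
      t * ρ ^ 4 * (q * l ^ 2)⁻¹ * D ^ 2 := by
  have hκ : a + b * Li ≤ 0 := by
    have h1 := mul_nonneg hK0 hh0
    have h2 := mul_nonneg hε0 (sub_nonneg.2 hα)
    have h3 := mul_nonneg hK0 hLi
    rw [ha, hb]
    linarith
  have s1 : 0 ≤ t * (q * l ^ 2)⁻¹ * (ρ ^ 2 * D + 2 * ε * f * (q * l ^ 2)) ^ 2 := by positivity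
  have s2 : 0 ≤ 4 * K * (t * ρ ^ 2 * q) * (G - w ^ 2) :=
    mul_nonneg (by positivity) (sub_nonneg.2 hG)
  have s3 : 0 ≤ t * q * (4 * K) * (ρ * w + (h + Li / 2) * f * l) ^ 2 := by positivity
  have s4 : 0 ≤ -(a + b * Li) * (m - 1) * (σ - 1) * (t * f ^ 2 * (q * l ^ 2)) :=
    mul_nonneg (mul_nonneg (mul_nonneg (neg_nonneg.2 hκ) (sub_nonneg.2 hm)) (sub_nonneg.2 hσ))
      (by positivity)
  rw [← sub_nonneg]
  refine (add_nonneg (add_nonneg (add_nonneg s1 s2) s3) s4).trans_eq ?_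
  subst hb ha hK hε hh
  field_simp
  ring

section correctionField

variable {n : ℕ}

/-- The vector field whose divergence realises the integrations by parts in the Rellich
inequality. -/
noncomputable def correctionField (α R ε a b : ℝ) (φ : EuclideanSpace ℝ (Fin n) → ℝ)
    (y : EuclideanSpace ℝ (Fin n)) : EuclideanSpace ℝ (Fin n) :=
  (-4 * ε * φ y * hypRadius ‖y‖ ^ (α - 2)) • (lam y ^ ((n : ℝ) - 2) • gradient φ y) +
    (φ y ^ 2 * radialProfile n α R a b ‖y‖) • y

variable {φ : EuclideanSpace ℝ (Fin n) → ℝ} {x : EuclideanSpace ℝ (Fin n)}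

lemma contDiff_gradient (hφ : ContDiff ℝ (⊤ : ℕ∞) φ) : ContDiff ℝ (⊤ : ℕ∞) (gradient φ) :=
  (InnerProductSpace.toDual ℝ (EuclideanSpace ℝ (Fin n))).symm.contDiff.comp
    (hφ.fderiv_right (m := (⊤ : ℕ∞)) (by simp))

lemma contDiffAt_lam (hx : ‖x‖ < 1) : ContDiffAt ℝ (⊤ : ℕ∞) lam x :=
  contDiffAt_const.div (contDiffAt_const.sub (contDiff_norm_sq ℝ).contDiffAt)
    (by nlinarith [norm_nonneg x])

lemma lam_pos (hx : ‖x‖ < 1) : 0 < lam x := conformalRadial_pos (norm_nonneg x) hx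

lemma dH_pos (hx0 : x ≠ 0) (hx : ‖x‖ < 1) : 0 < dH x := hypRadius_pos (norm_pos_iff.2 hx0) hx

lemma contDiffAt_dH (hx0 : x ≠ 0) (hx : ‖x‖ < 1) : ContDiffAt ℝ (⊤ : ℕ∞) dH x := by
  have h1 : 1 - ‖x‖ ≠ 0 := by linarith
  have h2 : 1 + ‖x‖ ≠ 0 := by linarith [norm_nonneg x]
  have hn : ContDiffAt ℝ (⊤ : ℕ∞) (fun y : EuclideanSpace ℝ (Fin n) => ‖y‖) x :=
    contDiffAt_norm ℝ hx0
  exact ((contDiffAt_const.add hn).div (contDiffAt_const.sub hn) h1).log (div_ne_zero h2 h1)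

lemma contDiffAt_weightedGradient (hφ : ContDiff ℝ (⊤ : ℕ∞) φ) (p : ℝ) (hx : ‖x‖ < 1) :
    ContDiffAt ℝ (⊤ : ℕ∞) (fun y => lam y ^ p • gradient φ y) x :=
  ((contDiffAt_lam hx).rpow_const_of_ne (lam_pos hx).ne').smul (contDiff_gradient hφ).contDiffAt

lemma log_div_dH_pos {R : ℝ} (hx0 : x ≠ 0) (hx : ‖x‖ < 1) (hR : dH x < R) :
    0 < Real.log (R / dH x) :=
  Real.log_pos ((one_lt_div (dH_pos hx0 hx)).2 hR)

lemma contDiffAt_log_div_dH {R : ℝ} (hx0 : x ≠ 0) (hx : ‖x‖ < 1) (hR : dH x < R) :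
    ContDiffAt ℝ (⊤ : ℕ∞) (fun y => Real.log (R / dH y)) x :=
  (contDiffAt_const.div (contDiffAt_dH hx0 hx) (dH_pos hx0 hx).ne').log
    (div_ne_zero ((dH_pos hx0 hx).trans hR).ne' (dH_pos hx0 hx).ne')

lemma contDiffAt_radialProfile {m α R a b : ℝ} (hx0 : x ≠ 0) (hx : ‖x‖ < 1) (hR : dH x < R) :
    ContDiffAt ℝ (⊤ : ℕ∞) (fun y => radialProfile m α R a b ‖y‖) x :=
  ((((contDiffAt_dH hx0 hx).rpow_const_of_ne (dH_pos hx0 hx).ne').mul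
    (contDiffAt_const.add (contDiffAt_const.mul
      ((contDiffAt_log_div_dH hx0 hx hR).inv (log_div_dH_pos hx0 hx hR).ne')))).mul
    ((contDiffAt_lam hx).rpow_const_of_ne (lam_pos hx).ne')).mul
    ((contDiffAt_norm ℝ hx0).inv (norm_ne_zero_iff.2 hx0))

lemma contDiffAt_hypRadius_rpow (p : ℝ) (hx0 : x ≠ 0) (hx : ‖x‖ < 1) :
    ContDiffAt ℝ (⊤ : ℕ∞) (fun y : EuclideanSpace ℝ (Fin n) => hypRadius ‖y‖ ^ p) x :=
  (contDiffAt_dH hx0 hx).rpow_const_of_ne (dH_pos hx0 hx).ne'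

lemma contDiffAt_correctionField {α R ε a b : ℝ} (hφ : ContDiff ℝ (⊤ : ℕ∞) φ) (hx0 : x ≠ 0)
    (hx : ‖x‖ < 1) (hR : dH x < R) :
    ContDiffAt ℝ (⊤ : ℕ∞) (correctionField α R ε a b φ) x :=
  (((contDiffAt_const.mul hφ.contDiffAt).mul (contDiffAt_hypRadius_rpow _ hx0 hx)).smul
    (contDiffAt_weightedGradient hφ _ hx)).add
    (((hφ.contDiffAt.pow 2).mul (contDiffAt_radialProfile hx0 hx hR)).smul contDiffAt_id)

lemma dvg_correctionField {α R ε a b : ℝ} (hφ : ContDiff ℝ (⊤ : ℕ∞) φ) (hx0 : x ≠ 0)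
    (hx : ‖x‖ < 1) (hR : dH x < R) :
    dvg (correctionField α R ε a b φ) x =
      -4 * ε * (dH x ^ (α - 2) * φ x * dvg (fun y => lam y ^ ((n : ℝ) - 2) • gradient φ y) x +
        lam x ^ ((n : ℝ) - 2) * (dH x ^ (α - 2) * ‖gradient φ x‖ ^ 2 +
          φ x * (α - 2) * dH x ^ (α - 3) * lam x * (inner ℝ x (gradient φ x) / ‖x‖))) +
      2 * φ x * (inner ℝ x (gradient φ x) / ‖x‖) * dH x ^ (α - 3) *
        (a + b * (Real.log (R / dH x))⁻¹) * lam x ^ ((n : ℝ) - 1) +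
      φ x ^ 2 * (dH x ^ (α - 4) * lam x ^ (n : ℝ) *
        ((α - 3) * (a + b * (Real.log (R / dH x))⁻¹) + b * (Real.log (R / dH x))⁻¹ ^ 2 +
          ((n : ℝ) - 1) * (dH x * ((1 + ‖x‖ ^ 2) / (2 * ‖x‖))) *
            (a + b * (Real.log (R / dH x))⁻¹))) := by
  have hr : 0 < ‖x‖ := norm_pos_iff.2 hx0
  have dφ : DifferentiableAt ℝ φ x := hφ.differentiable (by simp) x
  have dA : DifferentiableAt ℝ (fun y => -4 * ε * φ y * hypRadius ‖y‖ ^ (α - 2)) x :=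
    (dφ.const_mul _).mul ((contDiffAt_hypRadius_rpow _ hx0 hx).differentiableAt (by simp))
  have dX := (contDiffAt_weightedGradient hφ ((n : ℝ) - 2) hx).differentiableAt (by simp)
  have dB : DifferentiableAt ℝ (fun y => φ y ^ 2 * radialProfile n α R a b ‖y‖) x :=
    (dφ.pow 2).mul ((contDiffAt_radialProfile hx0 hx hR).differentiableAt (by simp))
  have hgrad : ∀ v, fderiv ℝ φ x v = inner ℝ (gradient φ x) v := fun v =>
    (inner_gradient_left ..).symm
  have e1 : α - 2 - 1 = α - 3 := by ring
  have hprof : radialProfile n α R a b ‖x‖ * ‖x‖ =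
      dH x ^ (α - 3) * (a + b * (Real.log (R / dH x))⁻¹) * lam x ^ ((n : ℝ) - 1) := by
    change hypRadius ‖x‖ ^ (α - 3) * _ * conformalRadial ‖x‖ ^ ((n : ℝ) - 1) * ‖x‖⁻¹ * ‖x‖ = _
    rw [mul_assoc, inv_mul_cancel₀ hr.ne', mul_one]
    rfl
  have hA : fderiv ℝ (fun y => -4 * ε * φ y * hypRadius ‖y‖ ^ (α - 2)) x
      (lam x ^ ((n : ℝ) - 2) • gradient φ x) = -4 * ε * (lam x ^ ((n : ℝ) - 2) *
        (dH x ^ (α - 2) * ‖gradient φ x‖ ^ 2 +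
          φ x * (α - 2) * dH x ^ (α - 3) * lam x * (inner ℝ x (gradient φ x) / ‖x‖))) := by
    rw [fderiv_mul_radial hx0 (dφ.const_mul _) (hasDerivAt_hypRadius_rpow (α - 2) hr hx), e1,
      fderiv_const_mul dφ]
    change (-4 * ε) • fderiv ℝ φ x _ * dH x ^ (α - 2) +
      -4 * ε * φ x * ((α - 2) * dH x ^ (α - 3) * lam x * _) = _
    rw [hgrad, inner_smul_right, inner_smul_right, real_inner_self_eq_norm_sq, smul_eq_mul]
    ring
  have hB : fderiv ℝ (fun y => φ y ^ 2 * radialProfile n α R a b ‖y‖) x x +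
      φ x ^ 2 * radialProfile n α R a b ‖x‖ * n =
      2 * φ x * (inner ℝ x (gradient φ x) / ‖x‖) * dH x ^ (α - 3) *
        (a + b * (Real.log (R / dH x))⁻¹) * lam x ^ ((n : ℝ) - 1) +
      φ x ^ 2 * (dH x ^ (α - 4) * lam x ^ (n : ℝ) *
        ((α - 3) * (a + b * (Real.log (R / dH x))⁻¹) + b * (Real.log (R / dH x))⁻¹ ^ 2 +
          ((n : ℝ) - 1) * (dH x * ((1 + ‖x‖ ^ 2) / (2 * ‖x‖))) *
            (a + b * (Real.log (R / dH x))⁻¹))) := by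
    have hsq : fderiv ℝ (fun y => φ y ^ 2) x x = 2 * φ x * inner ℝ x (gradient φ x) := by
      rw [fderiv_fun_pow 2 dφ, real_inner_comm, ← hgrad]
      simp
    rw [fderiv_mul_radial (ψ := fun y => φ y ^ 2) hx0 (dφ.pow 2)
      (hasDerivAt_radialProfile n α a b hr hx hR), hsq, real_inner_self_eq_norm_sq]
    have h3 : 2 * φ x * (inner ℝ x (gradient φ x) / ‖x‖) * dH x ^ (α - 3) *
        (a + b * (Real.log (R / dH x))⁻¹) * lam x ^ ((n : ℝ) - 1) =
        2 * φ x * inner ℝ x (gradient φ x) * radialProfile n α R a b ‖x‖ := by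
      calc _ = 2 * φ x * (inner ℝ x (gradient φ x) / ‖x‖) *
            (radialProfile n α R a b ‖x‖ * ‖x‖) := by rw [hprof]; ring
        _ = _ := by field_simp
    rw [h3]
    change _ + φ x ^ 2 * (‖x‖⁻¹ * (dH x ^ (α - 4) * lam x ^ (n : ℝ) *
        ((α - 3) * (a + b * (Real.log (R / dH x))⁻¹) + b * (Real.log (R / dH x))⁻¹ ^ 2 +
          ((n : ℝ) - 1) * (dH x * ((1 + ‖x‖ ^ 2) / (2 * ‖x‖))) *
            (a + b * (Real.log (R / dH x))⁻¹)) - n * radialProfile n α R a b ‖x‖) *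
              (‖x‖ ^ 2 / ‖x‖)) + _ = _
    generalize radialProfile n α R a b ‖x‖ = P
    generalize Real.log (R / dH x) = L
    have : ∀ Z : ℝ, ‖x‖⁻¹ * Z * (‖x‖ ^ 2 / ‖x‖) = Z := fun Z => by field_simp
    rw [this]
    ring
  change dvg (fun y => (-4 * ε * φ y * hypRadius ‖y‖ ^ (α - 2)) •
    (lam y ^ ((n : ℝ) - 2) • gradient φ y) + (φ y ^ 2 * radialProfile n α R a b ‖y‖) • y) x = _
  rw [dvg_add (V := fun y => (-4 * ε * φ y * hypRadius ‖y‖ ^ (α - 2)) •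
      (lam y ^ ((n : ℝ) - 2) • gradient φ y))
    (W := fun y => (φ y ^ 2 * radialProfile n α R a b ‖y‖) • y)
    (dA.smul dX) (dB.smul differentiableAt_id), dvg_smul dA dX,
    dvg_smul (X := fun y => y) dB differentiableAt_id, dvg_id, hA, hB]
  change _ + -4 * ε * φ x * dH x ^ (α - 2) * _ + _ = _
  ring

/-- The pointwise inequality which, once integrated, gives the improved Rellich inequality. -/
lemma rellich_pointwise {α R h ε K a b : ℝ}
    (hh : h = ((n : ℝ) + α - 4) / 2) (hε : ε = h * ((n : ℝ) - α) / 4)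
    (hK : K = ((n : ℝ) - α) * ((n : ℝ) + 3 * α - 8) / 16)
    (ha : a = -4 * K * h - 2 * ε * (2 - α)) (hb : b = -2 * K)
    (hn : 2 < n) (hα₁ : (8 - (n : ℝ)) / 3 < α) (hα₂ : α < 2)
    (hφ : ContDiff ℝ (⊤ : ℕ∞) φ) (hx0 : x ≠ 0) (hx : ‖x‖ < 1) (hR : dH x < R) :
    ((n : ℝ) - α) ^ 2 / 4 * (dH x ^ (α - 2) * ‖gradient φ x‖ ^ 2 * lam x ^ ((n : ℝ) - 2)) +
        K * (dH x ^ (α - 4) * (φ x ^ 2 / Real.log (R / dH x) ^ 2) * lam x ^ (n : ℝ)) +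
        dvg (correctionField α R ε a b φ) x ≤
      dH x ^ α * lam x ^ (-(n : ℝ)) *
        (dvg (fun y => lam y ^ ((n : ℝ) - 2) • gradient φ y) x) ^ 2 := by
  have hn' : (2 : ℝ) < n := by exact_mod_cast hn
  have hr : 0 < ‖x‖ := norm_pos_iff.2 hx0
  have hρ := dH_pos hx0 hx
  have hl := lam_pos hx
  have hL := log_div_dH_pos hx0 hx hR
  have hh0 : 0 ≤ h := by rw [hh]; linarith
  have hε0 : 0 ≤ ε := by
    rw [hε]
    exact div_nonneg (mul_nonneg hh0 (by linarith)) (by norm_num)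
  have hK0 : 0 ≤ K := by
    rw [hK]
    exact div_nonneg (mul_nonneg (by linarith) (by linarith)) (by norm_num)
  have hw : (inner ℝ x (gradient φ x) / ‖x‖) ^ 2 ≤ ‖gradient φ x‖ ^ 2 := by
    rw [div_pow, div_le_iff₀ (by positivity), ← mul_pow, mul_comm]
    exact sq_le_sq' (neg_le_of_abs_le (abs_real_inner_le_norm _ _))
      (real_inner_le_norm _ _)
  have p1 : dH x ^ (α - 3) = dH x ^ (α - 4) * dH x := by
    rw [← Real.rpow_add_one hρ.ne']; ring_nf
  have p2 : dH x ^ (α - 2) = dH x ^ (α - 4) * dH x ^ 2 := by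
    rw [← Real.rpow_natCast, ← Real.rpow_add hρ]; norm_num; ring_nf
  have p4 : dH x ^ α = dH x ^ (α - 4) * dH x ^ 4 := by
    rw [← Real.rpow_natCast, ← Real.rpow_add hρ]; norm_num
  have q1 : lam x ^ ((n : ℝ) - 1) = lam x ^ ((n : ℝ) - 2) * lam x := by
    rw [← Real.rpow_add_one hl.ne']; ring_nf
  have q2 : lam x ^ (n : ℝ) = lam x ^ ((n : ℝ) - 2) * lam x ^ 2 := by
    rw [← Real.rpow_natCast (lam x) 2, ← Real.rpow_add hl]; norm_num
  rw [dvg_correctionField hφ hx0 hx hR, Real.rpow_neg hl.le, p1, p2, p4, q1, q2]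
  have key := rellich_algebraic (ρ := dH x) (f := φ x)
    (D := dvg (fun y => lam y ^ ((n : ℝ) - 2) • gradient φ y) x) hh hε hK ha hb
    (by linarith) hh0 hε0 hK0 hα₂.le
    (Real.rpow_pos_of_pos hρ (α - 4)) (Real.rpow_pos_of_pos hl ((n : ℝ) - 2)) hl
    (inv_nonneg.2 hL.le) (one_le_hypRadius_mul_coth hr hx) hw
  rw [div_eq_mul_inv (φ x ^ 2), ← inv_pow]
  refine le_trans (le_of_eq ?_) key
  change _ = _ + (_ + φ x ^ 2 * (_ * _ * (_ + _ + ((n : ℝ) - 1) *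
    (dH x * ((1 + ‖x‖ ^ 2) / (2 * ‖x‖))) * _)))
  ring

end correctionField

lemma integrable_of_continuousAt_of_forall_notMem {X : Type*} [TopologicalSpace X]
    [MeasurableSpace X] [BorelSpace X] [T2Space X] {μ : Measure X}
    [IsFiniteMeasureOnCompacts μ] {f : X → ℝ} {K : Set X} (hK : IsCompact K)
    (hf : ∀ x ∈ K, ContinuousAt f x) (h0 : ∀ x, x ∉ K → f x = 0) : Integrable f μ := by
  rw [← integrableOn_iff_integrable_of_support_subset (s := K)
    (fun x hx => by_contra fun h => hx (h0 x h))]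
  have hc : ContinuousOn f K := fun x hx => (hf x hx).continuousWithinAt
  exact hc.integrableOn_compact hK

lemma contDiff_of_forall_mem_tsupport {E F : Type*} [NormedAddCommGroup E] [NormedSpace ℝ E]
    [NormedAddCommGroup F] [NormedSpace ℝ F] {k : WithTop ℕ∞} {f : E → F}
    (hf : ∀ x ∈ tsupport f, ContDiffAt ℝ k f x) : ContDiff ℝ k f := by
  refine contDiff_iff_contDiffAt.2 fun x => ?_
  by_cases hx : x ∈ tsupport f
  · exact hf x hx
  · exact contDiffAt_const.congr_of_eventuallyEq (notMem_tsupport_iff_eventuallyEq.1 hx)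

/-- Improved Rellich inequality on a bounded domain in ℍⁿ with logarithmic
remainder (Corollary 3.1). -/
theorem improved_rellich_hyperbolic_log {n : ℕ} (hn : 2 < n)
    (Ω : Set (EuclideanSpace ℝ (Fin n))) (hΩ_open : IsOpen Ω) (hΩ_bdd : IsBounded Ω)
    (hΩ_sub : closure Ω ⊆ Metric.ball (0 : EuclideanSpace ℝ (Fin n)) 1)
    (α : ℝ) (hα₁ : (8 - (n : ℝ)) / 3 < α) (hα₂ : α < 2)
    (R : ℝ) (hR : ∀ x ∈ Ω, dH x < R)
    (φ : EuclideanSpace ℝ (Fin n) → ℝ)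
    (hφ_smooth : ContDiff ℝ (⊤ : ℕ∞) φ) (hφ_cpt : HasCompactSupport φ)
    (hφ_supp : tsupport φ ⊆ Ω \ {0}) :
    ((n : ℝ) - α) ^ 2 / 4 *
          (∫ x in Ω, dH x ^ (α - 2) * ‖gradient φ x‖ ^ 2 * lam x ^ ((n : ℝ) - 2)) +
        ((n : ℝ) - α) * ((n : ℝ) + 3 * α - 8) / 16 *
          ∫ x in Ω, dH x ^ (α - 4) * (φ x ^ 2 / Real.log (R / dH x) ^ 2) * lam x ^ (n : ℝ) ≤
      ∫ x in Ω, dH x ^ α * lam x ^ (-(n : ℝ)) *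
        (dvg (fun y => lam y ^ ((n : ℝ) - 2) • gradient φ y) x) ^ 2 := by
  have hΩ_ball : ∀ x ∈ Ω, ‖x‖ < 1 := fun x hx => by simpa using hΩ_sub (subset_closure hx)
  have hmem : ∀ x ∈ tsupport φ, x ≠ 0 ∧ ‖x‖ < 1 ∧ dH x < R := fun x hx =>
    ⟨(hφ_supp hx).2, hΩ_ball x (hφ_supp hx).1, hR x (hφ_supp hx).1⟩
  obtain ⟨h, hh⟩ : ∃ h, h = ((n : ℝ) + α - 4) / 2 := ⟨_, rfl⟩
  obtain ⟨ε, hε⟩ : ∃ ε, ε = h * ((n : ℝ) - α) / 4 := ⟨_, rfl⟩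
  obtain ⟨K, hK⟩ : ∃ K, K = ((n : ℝ) - α) * ((n : ℝ) + 3 * α - 8) / 16 := ⟨_, rfl⟩
  obtain ⟨a, ha⟩ : ∃ a, a = -4 * K * h - 2 * ε * (2 - α) := ⟨_, rfl⟩
  obtain ⟨b, hb⟩ : ∃ b, b = -2 * K := ⟨_, rfl⟩
  have hφ0 : ∀ x, x ∉ tsupport φ → φ x = 0 := fun x hx => image_eq_zero_of_notMem_tsupport hx
  have hgrad0 : ∀ x, x ∉ tsupport φ → gradient φ x = 0 := fun x hx => by
    have : fderiv ℝ φ x = 0 := by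
      by_contra hne
      exact hx (support_fderiv_subset ℝ hne)
    simp [gradient, this]
  have hX_supp : tsupport (fun y => lam y ^ ((n : ℝ) - 2) • gradient φ y) ⊆ tsupport φ :=
    closure_minimal (fun x hx => by_contra fun hne => hx (by simp [hgrad0 x hne]))
      (isClosed_tsupport φ)
  have hV_supp : tsupport (correctionField α R ε a b φ) ⊆ tsupport φ :=
    closure_minimal (fun x hx => by_contra fun hne => hx (by simp [correctionField, hφ0 x hne]))
      (isClosed_tsupport φ)
  have hD0 : ∀ x, x ∉ tsupport φ → dvg (fun y => lam y ^ ((n : ℝ) - 2) • gradient φ y) x = 0 :=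
    fun x hx => dvg_eq_zero_of_notMem_tsupport fun h' => hx (hX_supp h')
  have hV0 : ∀ x, x ∉ tsupport φ → dvg (correctionField α R ε a b φ) x = 0 :=
    fun x hx => dvg_eq_zero_of_notMem_tsupport fun h' => hx (hV_supp h')
  have hX_smooth : ContDiff ℝ 1 (fun y => lam y ^ ((n : ℝ) - 2) • gradient φ y) :=
    contDiff_of_forall_mem_tsupport fun x hx =>
      (contDiffAt_weightedGradient hφ_smooth _ (hmem x (hX_supp hx)).2.1).of_le
        (by exact_mod_cast le_top)
  have hV_smooth : ContDiff ℝ 1 (correctionField α R ε a b φ) :=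
    contDiff_of_forall_mem_tsupport fun x hx => by
      obtain ⟨h1, h2, h3⟩ := hmem x (hV_supp hx)
      exact (contDiffAt_correctionField hφ_smooth h1 h2 h3).of_le (by exact_mod_cast le_top)
  have hV_cpt : HasCompactSupport (correctionField α R ε a b φ) :=
    hφ_cpt.of_isClosed_subset (isClosed_tsupport _) hV_supp
  have hD_cont : Continuous (dvg (fun y => lam y ^ ((n : ℝ) - 2) • gradient φ y)) :=
    continuous_finsetSum _ fun i _ => (EuclideanSpace.proj (𝕜 := ℝ) i).continuous.comp
      ((hX_smooth.continuous_fderiv one_ne_zero).clm_apply continuous_const)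
  have hd : ∀ p : ℝ, ∀ x ∈ tsupport φ, ContinuousAt (fun y => dH y ^ p) x := fun p x hx =>
    (contDiffAt_dH (hmem x hx).1 (hmem x hx).2.1).continuousAt.rpow_const
      (Or.inl (dH_pos (hmem x hx).1 (hmem x hx).2.1).ne')
  have hlam : ∀ p : ℝ, ∀ x ∈ tsupport φ, ContinuousAt (fun y => lam y ^ p) x := fun p x hx =>
    (contDiffAt_lam (hmem x hx).2.1).continuousAt.rpow_const
      (Or.inl (lam_pos (hmem x hx).2.1).ne')
  have i1 : Integrable fun x => dH x ^ (α - 2) * ‖gradient φ x‖ ^ 2 * lam x ^ ((n : ℝ) - 2) :=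
    integrable_of_continuousAt_of_forall_notMem hφ_cpt
      (fun x hx => ((hd _ x hx).mul
        ((contDiff_gradient hφ_smooth).continuous.continuousAt.norm.pow 2)).mul (hlam _ x hx))
      (fun x hx => by simp [hgrad0 x hx])
  have i2 : Integrable fun x =>
      dH x ^ (α - 4) * (φ x ^ 2 / Real.log (R / dH x) ^ 2) * lam x ^ (n : ℝ) :=
    integrable_of_continuousAt_of_forall_notMem hφ_cpt
      (fun x hx => by
        obtain ⟨h1, h2, h3⟩ := hmem x hx
        exact ((hd _ x hx).mul ((hφ_smooth.continuous.continuousAt.pow 2).div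
          ((contDiffAt_log_div_dH h1 h2 h3).continuousAt.pow 2)
          (pow_ne_zero 2 (log_div_dH_pos h1 h2 h3).ne'))).mul (hlam _ x hx))
      (fun x hx => by simp [hφ0 x hx])
  have i3 : Integrable fun x => dH x ^ α * lam x ^ (-(n : ℝ)) *
      (dvg (fun y => lam y ^ ((n : ℝ) - 2) • gradient φ y) x) ^ 2 :=
    integrable_of_continuousAt_of_forall_notMem hφ_cpt
      (fun x hx => ((hd _ x hx).mul (hlam _ x hx)).mul (hD_cont.continuousAt.pow 2))
      (fun x hx => by simp [hD0 x hx])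
  have hout : ∀ x, x ∉ Ω → x ∉ tsupport φ := fun x hx h' => hx (hφ_supp h').1
  rw [setIntegral_eq_integral_of_forall_compl_eq_zero fun x hx => by simp [hgrad0 x (hout x hx)],
    setIntegral_eq_integral_of_forall_compl_eq_zero fun x hx => by simp [hφ0 x (hout x hx)],
    setIntegral_eq_integral_of_forall_compl_eq_zero fun x hx => by simp [hD0 x (hout x hx)],
    ← hK, ← add_zero (_ + _), ← integral_dvg_eq_zero hV_smooth hV_cpt, ← integral_const_mul,
    ← integral_const_mul, ← integral_add (i1.const_mul _) (i2.const_mul _),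
    ← integral_add (f := fun x => _ + _) ((i1.const_mul _).add (i2.const_mul _))
      (integrable_dvg hV_smooth hV_cpt)]
  refine integral_mono (((i1.const_mul _).add (i2.const_mul _)).add
    (integrable_dvg hV_smooth hV_cpt)) i3 fun x => ?_
  by_cases hx : x ∈ tsupport φ
  · obtain ⟨h1, h2, h3⟩ := hmem x hx
    exact rellich_pointwise hh hε hK ha hb hn hα₁ hα₂ hφ_smooth h1 h2 h3
  · simp [hφ0 x hx, hgrad0 x hx, hD0 x hx, hV0 x hx]
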